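/- Let n ≥ 2, let B be the open unit ball of ℝⁿ, let α > 0, let G be an N-function with complementary function G̃, and let H be an N-function satisfying q⁻ H(t) ≤ t H'(t) ≤ q⁺ H(t) for all t > 0 with 1 < q⁻ ≤ q⁺ < ∞. Assume the integrability condition K := ∫_0^1 r^{α+n−1} H(N_G̃(r)) dr < ∞, where N_G̃(r) = inf{λ > 0 : ∫_r^1 G̃(s^{1−n}/λ) s^{n−1} ds ≤ 1}. Then there exists a constant C > 0 depending only on n, q⁻, q⁺ such that for every radial function u ∈ C¹(B̄) vanishing on ∂B: ∫_B |x|^α H(|u(x)|) dx ≤ C · max(‖∇u‖_{L^G(B)}^{q⁻}, ‖∇u‖_{L^G(B)}^{q⁺}) · K < ∞, where ‖∇u‖_{L^G(B)} = inf{λ > 0 : ∫_B G(|∇u(y)|/λ) dy ≤ 1}. -/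

import Mathlib

open MeasureTheory Metric

/-- `G : [0,∞) → [0,∞)` is an N-function with derivative `g = G'`: it is convex, increasing,
vanishes at `0`, is sublinear at `0` and superlinear at `∞`, and is differentiable on `(0,∞)`
with nondecreasing positive derivative `g`. -/
structure IsNFunction (G g : ℝ → ℝ) : Prop where
  map_zero : G 0 = 0
  convex : ConvexOn ℝ (Set.Ici 0) G
  strictMono : StrictMonoOn G (Set.Ici 0)
  hasDeriv : ∀ t > 0, HasDerivAt G (g t) t
  deriv_pos : ∀ t > 0, 0 < g t
  deriv_mono : MonotoneOn g (Set.Ioi 0)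
  tendsto_zero : Filter.Tendsto (fun t => G t / t) (nhdsWithin 0 (Set.Ioi 0)) (nhds 0)
  tendsto_top : Filter.Tendsto (fun t => G t / t) Filter.atTop Filter.atTop

/-- The complementary N-function `G̃(t) = sup { t w - G(w) : w > 0 }`. -/
noncomputable def complementaryFn (G : ℝ → ℝ) (t : ℝ) : ℝ :=
  sSup ((fun w => t * w - G w) '' Set.Ioi 0)

/-- The Luxemburg norm `‖s^{1-n}‖_{L^{G̃}((r,1), s^{n-1} ds)}`. -/
noncomputable def weightedTailNorm (n : ℕ) (G : ℝ → ℝ) (r : ℝ) : ℝ :=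
  sInf {l : ℝ | 0 < l ∧
    (∫ s in r..1, complementaryFn G (s ^ ((1:ℝ) - n) / l) * s ^ ((n:ℝ) - 1)) ≤ 1}

/-- The Luxemburg norm `‖∇u‖_{L^G(B)}` over the unit ball of `ℝⁿ`. -/
noncomputable def gradLuxemburgNorm (n : ℕ) (G : ℝ → ℝ)
    (u : EuclideanSpace ℝ (Fin n) → ℝ) : ℝ :=
  sInf {l : ℝ | 0 < l ∧
    (∫ y in ball (0:EuclideanSpace ℝ (Fin n)) 1, G (‖gradient u y‖ / l)) ≤ 1}


namespace IsNFunction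

variable {G g : ℝ → ℝ}

lemma nonneg' (hG : IsNFunction G g) {t : ℝ} (ht : 0 ≤ t) : 0 ≤ G t := by
  have := hG.strictMono.monotoneOn (Set.mem_Ici.2 le_rfl) (Set.mem_Ici.2 ht) ht
  rwa [hG.map_zero] at this

lemma pos' (hG : IsNFunction G g) {t : ℝ} (ht : 0 < t) : 0 < G t := by
  have := hG.strictMono (Set.mem_Ici.2 le_rfl) (Set.mem_Ici.2 ht.le) ht
  rwa [hG.map_zero] at this

lemma mono' (hG : IsNFunction G g) {s t : ℝ} (hs : 0 ≤ s) (hst : s ≤ t) : G s ≤ G t :=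
  hG.strictMono.monotoneOn (Set.mem_Ici.2 hs) (Set.mem_Ici.2 (hs.trans hst)) hst

lemma scale_le (hG : IsNFunction G g) {t c : ℝ} (ht : 0 ≤ t) (hc0 : 0 ≤ c) (hc : c ≤ 1) :
    G (c * t) ≤ c * G t := by
  have := hG.convex.2 (Set.mem_Ici.2 ht) (Set.mem_Ici.2 (le_refl (0:ℝ))) hc0
    (sub_nonneg.2 hc) (by ring)
  simpa [hG.map_zero] using this

lemma continuousOn' (hG : IsNFunction G g) : ContinuousOn G (Set.Ici 0) := by
  intro x hx
  rcases eq_or_lt_of_le (Set.mem_Ici.1 hx) with h | h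
  · subst h
    have h1 : Filter.Tendsto (fun t : ℝ => t * G 1) (nhdsWithin 0 (Set.Ici 0)) (nhds 0) := by
      have : Continuous (fun t : ℝ => t * G 1) := by fun_prop
      have := this.tendsto 0
      simp only [zero_mul] at this
      exact this.mono_left nhdsWithin_le_nhds
    unfold ContinuousWithinAt
    rw [hG.map_zero]
    refine tendsto_of_tendsto_of_tendsto_of_le_of_le' tendsto_const_nhds h1 ?_ ?_
    · filter_upwards [self_mem_nhdsWithin] with t ht using hG.nonneg' ht
    · filter_upwards [self_mem_nhdsWithin,
        mem_nhdsWithin_of_mem_nhds (Iic_mem_nhds (zero_lt_one))] with t ht ht1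
      simpa using hG.scale_le zero_le_one ht ht1
  · exact (hG.hasDeriv x h).continuousAt.continuousWithinAt

lemma compl_bdd (hG : IsNFunction G g) (t : ℝ) :
    BddAbove ((fun w => t * w - G w) '' Set.Ioi 0) := by
  obtain ⟨W, hW⟩ := Filter.eventually_atTop.1
    (hG.tendsto_top.eventually (Filter.eventually_ge_atTop t))
  refine ⟨|t| * |W|, ?_⟩
  rintro _ ⟨w, hw, rfl⟩
  have hw' : 0 < w := hw
  have hGw := hG.nonneg' hw'.le
  simp only
  rcases le_total W w with h | h
  · have := hW w h
    rw [le_div_iff₀ hw'] at this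
    have : 0 ≤ |t| * |W| := by positivity
    linarith
  · have h1 : t * w ≤ |t| * w := mul_le_mul_of_nonneg_right (le_abs_self t) hw'.le
    have h2 : |t| * w ≤ |t| * |W| :=
      mul_le_mul_of_nonneg_left (h.trans (le_abs_self W)) (abs_nonneg t)
    linarith

/-- Young inequality. -/
lemma young (hG : IsNFunction G g) {t w : ℝ} (ht : 0 ≤ t) (hw : 0 ≤ w) :
    w * t ≤ G w + complementaryFn G t := by
  rcases eq_or_lt_of_le hw with h | h
  · subst h
    have h0 : 0 ≤ complementaryFn G t := by
      by_contra hneg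
      push Not at hneg
      have hc : Filter.Tendsto (fun w => t * w - G w) (nhdsWithin 0 (Set.Ioi 0)) (nhds 0) := by
        have h1 : ContinuousWithinAt (fun w => t * w - G w) (Set.Ici 0) 0 :=
          (continuous_const.mul continuous_id).continuousWithinAt.sub
            (hG.continuousOn' 0 (Set.mem_Ici.2 le_rfl))
        have h2 := h1.tendsto
        simp only [mul_zero, hG.map_zero, sub_zero] at h2
        exact h2.mono_left (nhdsWithin_mono _ Set.Ioi_subset_Ici_self)
      have := le_of_tendsto (b := complementaryFn G t) hc (by
        filter_upwards [self_mem_nhdsWithin] with w hw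
        exact le_csSup (hG.compl_bdd t) ⟨w, hw, rfl⟩)
      linarith
    simpa [hG.map_zero] using h0
  · have := le_csSup (hG.compl_bdd t) ⟨w, h, rfl⟩
    simp only at this
    change t * w - G w ≤ complementaryFn G t at this
    linarith

lemma compl_nonneg (hG : IsNFunction G g) {t : ℝ} (ht : 0 ≤ t) : 0 ≤ complementaryFn G t := by
  simpa [hG.map_zero] using hG.young ht le_rfl

lemma compl_zero (hG : IsNFunction G g) : complementaryFn G 0 = 0 := by
  refine le_antisymm ?_ (hG.compl_nonneg le_rfl)
  refine csSup_le ((Set.nonempty_Ioi).image _) ?_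
  rintro _ ⟨w, hw, rfl⟩
  have := hG.nonneg' (le_of_lt hw)
  simp only [zero_mul]
  linarith

lemma compl_convex (hG : IsNFunction G g) : ConvexOn ℝ Set.univ (complementaryFn G) := by
  refine ⟨convex_univ, ?_⟩
  intro x _ y _ a b ha hb hab
  refine csSup_le ((Set.nonempty_Ioi).image _) ?_
  rintro _ ⟨w, hw, rfl⟩
  have h1 : x * w - G w ≤ complementaryFn G x := le_csSup (hG.compl_bdd x) ⟨w, hw, rfl⟩
  have h2 : y * w - G w ≤ complementaryFn G y := le_csSup (hG.compl_bdd y) ⟨w, hw, rfl⟩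
  have h3 := mul_le_mul_of_nonneg_left h1 ha
  have h4 := mul_le_mul_of_nonneg_left h2 hb
  have h5 : G w = a * G w + b * G w := by rw [← add_mul, hab, one_mul]
  simp only [smul_eq_mul]
  nlinarith

lemma compl_continuous (hG : IsNFunction G g) : Continuous (complementaryFn G) :=
  hG.compl_convex.locallyLipschitz.continuous

lemma compl_scale (hG : IsNFunction G g) {t c : ℝ} (hc0 : 0 ≤ c) (hc : c ≤ 1) :
    complementaryFn G (c * t) ≤ c * complementaryFn G t := by
  have := hG.compl_convex.2 (Set.mem_univ t) (Set.mem_univ 0) hc0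
    (sub_nonneg.2 hc) (by ring)
  simpa [hG.compl_zero] using this

lemma growth_ge {qp : ℝ} (hG : IsNFunction G g) (hq : ∀ t > 0, t * g t ≤ qp * G t)
    {s t : ℝ} (hs : 0 < s) (hst : s ≤ t) : G t ≤ (t / s) ^ qp * G s := by
  have hd : ∀ x > 0, HasDerivAt (fun x => G x * x ^ (-qp))
      (g x * x ^ (-qp) + G x * (-qp * x ^ (-qp - 1))) x := fun x hx =>
    (hG.hasDeriv x hx).mul (Real.hasDerivAt_rpow_const (Or.inl hx.ne'))
  have hanti : AntitoneOn (fun x => G x * x ^ (-qp)) (Set.Ioi 0) := by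
    refine antitoneOn_of_deriv_nonpos (convex_Ioi 0)
      (fun x hx => (hd x hx).continuousAt.continuousWithinAt) ?_ ?_
    · rw [interior_Ioi]
      exact fun x hx => (hd x hx).differentiableAt.differentiableWithinAt
    · rw [interior_Ioi]
      intro x hx
      have hx' : 0 < x := hx
      rw [(hd x hx).deriv]
      have e : x ^ (-qp) = x * x ^ (-qp - 1) := by
        rw [Real.rpow_sub_one hx'.ne']; field_simp
      rw [e]
      have : 0 < x ^ (-qp - 1) := Real.rpow_pos_of_pos hx' _
      have h2 := hq x hx'
      nlinarith
  have ht : 0 < t := hs.trans_le hst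
  have := hanti hs ht hst
  simp only at this
  rw [Real.rpow_neg ht.le, Real.rpow_neg hs.le] at this
  have h3 : 0 < t ^ qp := Real.rpow_pos_of_pos ht _
  have h4 : 0 < s ^ qp := Real.rpow_pos_of_pos hs _
  rw [Real.div_rpow ht.le hs.le]
  rw [← div_eq_mul_inv, ← div_eq_mul_inv, div_le_iff₀ h3] at this
  calc G t ≤ _ := this
    _ = _ := by field_simp

lemma growth_le {qm : ℝ} (hG : IsNFunction G g) (hq : ∀ t > 0, qm * G t ≤ t * g t)
    {s t : ℝ} (hs : 0 < s) (hst : s ≤ t) : G s ≤ (s / t) ^ qm * G t := by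
  have hd : ∀ x > 0, HasDerivAt (fun x => G x * x ^ (-qm))
      (g x * x ^ (-qm) + G x * (-qm * x ^ (-qm - 1))) x := fun x hx =>
    (hG.hasDeriv x hx).mul (Real.hasDerivAt_rpow_const (Or.inl hx.ne'))
  have hmono : MonotoneOn (fun x => G x * x ^ (-qm)) (Set.Ioi 0) := by
    refine monotoneOn_of_deriv_nonneg (convex_Ioi 0)
      (fun x hx => (hd x hx).continuousAt.continuousWithinAt) ?_ ?_
    · rw [interior_Ioi]
      exact fun x hx => (hd x hx).differentiableAt.differentiableWithinAt
    · rw [interior_Ioi]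
      intro x hx
      have hx' : 0 < x := hx
      rw [(hd x hx).deriv]
      have e : x ^ (-qm) = x * x ^ (-qm - 1) := by
        rw [Real.rpow_sub_one hx'.ne']; field_simp
      rw [e]
      have : 0 < x ^ (-qm - 1) := Real.rpow_pos_of_pos hx' _
      have h2 := hq x hx'
      nlinarith
  have ht : 0 < t := hs.trans_le hst
  have := hmono hs ht hst
  simp only at this
  rw [Real.rpow_neg ht.le, Real.rpow_neg hs.le] at this
  have h3 : 0 < t ^ qm := Real.rpow_pos_of_pos ht _
  have h4 : 0 < s ^ qm := Real.rpow_pos_of_pos hs _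
  rw [Real.div_rpow hs.le ht.le]
  rw [← div_eq_mul_inv, ← div_eq_mul_inv, div_le_iff₀ h4] at this
  calc G s ≤ _ := this
    _ = _ := by field_simp

lemma growth {qm qp : ℝ} (hG : IsNFunction G g)
    (hq : ∀ t > (0:ℝ), qm * G t ≤ t * g t ∧ t * g t ≤ qp * G t)
    {c t : ℝ} (hc : 0 ≤ c) (ht : 0 ≤ t) : G (c * t) ≤ max (c ^ qm) (c ^ qp) * G t := by
  rcases eq_or_lt_of_le hc with rfl | hc'
  · rw [zero_mul, hG.map_zero]
    exact mul_nonneg (le_max_of_le_left (Real.rpow_nonneg le_rfl _)) (hG.nonneg' ht)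
  rcases eq_or_lt_of_le ht with rfl | ht'
  · simp [hG.map_zero]
  have hGt := hG.nonneg' ht
  rcases le_total c 1 with h | h
  · have := hG.growth_le (fun t ht => (hq t ht).1) (mul_pos hc' ht')
      (mul_le_of_le_one_left ht h)
    rw [mul_div_cancel_right₀ _ ht'.ne'] at this
    exact this.trans (mul_le_mul_of_nonneg_right (le_max_left _ _) hGt)
  · have := hG.growth_ge (fun t ht => (hq t ht).2) ht' (le_mul_of_one_le_left ht h)
    rw [mul_div_cancel_right₀ _ ht'.ne'] at this
    exact this.trans (mul_le_mul_of_nonneg_right (le_max_right _ _) hGt)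

end IsNFunction

lemma tailNorm_nonneg (n : ℕ) (G : ℝ → ℝ) (r : ℝ) : 0 ≤ weightedTailNorm n G r :=
  Real.sInf_nonneg fun _ hl => hl.1.le

lemma gradNorm_nonneg (n : ℕ) (G : ℝ → ℝ) (u : EuclideanSpace ℝ (Fin n) → ℝ) :
    0 ≤ gradLuxemburgNorm n G u :=
  Real.sInf_nonneg fun _ hl => hl.1.le

lemma tail_contOn (n : ℕ) {G g : ℝ → ℝ} (hG : IsNFunction G g) {r : ℝ} (hr : 0 < r) (l : ℝ) :
    ContinuousOn (fun s : ℝ => complementaryFn G (s ^ ((1:ℝ) - n) / l) * s ^ ((n:ℝ) - 1))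
      (Set.Icc r 1) := by
  have h : ∀ p : ℝ, ContinuousOn (fun s : ℝ => s ^ p) (Set.Icc r 1) := fun p s hs =>
    (Real.continuousAt_rpow_const s p (Or.inl (hr.trans_le hs.1).ne')).continuousWithinAt
  exact (hG.compl_continuous.comp_continuousOn ((h _).div_const l)).mul (h _)

lemma tail_nonempty (n : ℕ) {G g : ℝ → ℝ} (hG : IsNFunction G g) {r : ℝ} (hr : 0 < r)
    (hr1 : r ≤ 1) :
    {l : ℝ | 0 < l ∧
    (∫ s in r..1, complementaryFn G (s ^ ((1:ℝ) - n) / l) * s ^ ((n:ℝ) - 1)) ≤ 1}.Nonempty := by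
  set I := ∫ s in r..1, complementaryFn G (s ^ ((1:ℝ) - n) / 1) * s ^ ((n:ℝ) - 1) with hI
  have hl : (1:ℝ) ≤ max 1 I := le_max_left _ _
  have hl0 : (0:ℝ) < max 1 I := zero_lt_one.trans_le hl
  refine ⟨max 1 I, hl0, ?_⟩
  have hle : (∫ s in r..1, complementaryFn G (s ^ ((1:ℝ) - n) / (max 1 I)) * s ^ ((n:ℝ) - 1))
      ≤ ∫ s in r..1, (max 1 I)⁻¹ *
        (complementaryFn G (s ^ ((1:ℝ) - n) / 1) * s ^ ((n:ℝ) - 1)) := by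
    refine intervalIntegral.integral_mono_on hr1 ?_ ?_ ?_
    · exact (tail_contOn n hG hr _).intervalIntegrable_of_Icc hr1
    · exact ((tail_contOn n hG hr _).intervalIntegrable_of_Icc hr1).const_mul _
    · intro s hs
      have hs0 : 0 ≤ s := (hr.trans_le hs.1).le
      have := hG.compl_scale (t := s ^ ((1:ℝ) - n)) (inv_nonneg.2 hl0.le) (inv_le_one_of_one_le₀ hl)
      rw [div_one, ← mul_assoc, div_eq_inv_mul]
      exact mul_le_mul_of_nonneg_right this (Real.rpow_nonneg hs0 _)
  rw [intervalIntegral.integral_const_mul, ← hI] at hle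
  refine hle.trans ?_
  rw [inv_mul_le_iff₀ hl0, mul_one]
  exact le_max_right _ _

lemma polar_ball (n : ℕ) (hn : 2 ≤ n) (f : ℝ → ℝ) :
    ∫ x in ball (0:EuclideanSpace ℝ (Fin n)) 1, f ‖x‖ =
      (n * (volume : Measure (EuclideanSpace ℝ (Fin n))).real (ball 0 1)) *
        ∫ r in (0:ℝ)..1, r ^ (n - 1) * f r := by
  have : Nonempty (Fin n) := ⟨⟨0, by omega⟩⟩
  have h1 := integral_fun_norm_addHaar (volume : Measure (EuclideanSpace ℝ (Fin n)))
    ((Set.Iio (1:ℝ)).indicator f)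
  have h2 : (fun x : EuclideanSpace ℝ (Fin n) => (Set.Iio (1:ℝ)).indicator f ‖x‖) =
      (ball (0:EuclideanSpace ℝ (Fin n)) 1).indicator (fun x => f ‖x‖) := by
    ext x
    by_cases hx : ‖x‖ < 1 <;> simp [Set.indicator, hx]
  have h3 : (fun y : ℝ => y ^ (n - 1) • (Set.Iio (1:ℝ)).indicator f y) =
      (Set.Iio (1:ℝ)).indicator (fun y => y ^ (n - 1) * f y) := by
    ext x
    by_cases hx : x < 1 <;> simp [Set.indicator, hx]
  rw [h2, integral_indicator measurableSet_ball, finrank_euclideanSpace_fin, h3,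
    setIntegral_indicator measurableSet_Iio, Set.Ioi_inter_Iio] at h1
  rw [h1, intervalIntegral.integral_of_le zero_le_one, integral_Ioc_eq_integral_Ioo]
  simp [mul_assoc]

section radial

variable {n : ℕ} {u : EuclideanSpace ℝ (Fin n) → ℝ}


lemma udiff_cB : UniqueDiffOn ℝ (closedBall (0:EuclideanSpace ℝ (Fin n)) 1) :=
  uniqueDiffOn_convex (convex_closedBall _ _) (by
    rw [interior_closedBall _ one_ne_zero]; exact ⟨0, by simp⟩)

lemma cB_nhds {x : EuclideanSpace ℝ (Fin n)} (hx : ‖x‖ < 1) : (closedBall (0:EuclideanSpace ℝ (Fin n)) 1) ∈ nhds x :=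
  Filter.mem_of_superset (isOpen_ball.mem_nhds (by simpa using hx)) ball_subset_closedBall

lemma norm_grad_eq {x : EuclideanSpace ℝ (Fin n)} (hx : ‖x‖ < 1) :
    ‖gradient u x‖ = ‖fderivWithin ℝ u (closedBall (0:EuclideanSpace ℝ (Fin n)) 1) x‖ := by
  rw [fderivWithin_of_mem_nhds (cB_nhds hx)]
  simp [gradient]

lemma grad_integrable {G g : ℝ → ℝ} (hG : IsNFunction G g) (hu : ContDiffOn ℝ 1 u (closedBall (0:EuclideanSpace ℝ (Fin n)) 1))
    {m : ℝ} (hm : 0 < m) :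
    IntegrableOn (fun y => G (‖gradient u y‖ / m)) (ball (0:EuclideanSpace ℝ (Fin n)) 1) := by
  have hc : ContinuousOn (fun y => G (‖fderivWithin ℝ u (closedBall (0:EuclideanSpace ℝ (Fin n)) 1) y‖ / m)) (closedBall (0:EuclideanSpace ℝ (Fin n)) 1) := by
    refine hG.continuousOn'.comp ((hu.continuousOn_fderivWithin udiff_cB le_rfl).norm.div_const m) ?_
    intro x _
    exact Set.mem_Ici.2 (by positivity)
  refine ((hc.integrableOn_compact (isCompact_closedBall _ _)).mono_set
    ball_subset_closedBall).congr_fun ?_ measurableSet_ball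
  intro x hx
  simp only
  rw [norm_grad_eq (by simpa using hx)]

lemma grad_nonempty {G g : ℝ → ℝ} (hG : IsNFunction G g) (hu : ContDiffOn ℝ 1 u (closedBall (0:EuclideanSpace ℝ (Fin n)) 1)) :
    {l : ℝ | 0 < l ∧
    (∫ y in ball (0:EuclideanSpace ℝ (Fin n)) 1, G (‖gradient u y‖ / l)) ≤ 1}.Nonempty := by
  set I := ∫ y in ball (0:EuclideanSpace ℝ (Fin n)) 1, G (‖gradient u y‖ / 1) with hI
  have hl : (1:ℝ) ≤ max 1 I := le_max_left _ _
  have hl0 : (0:ℝ) < max 1 I := zero_lt_one.trans_le hl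
  refine ⟨max 1 I, hl0, ?_⟩
  have hle : (∫ y in ball (0:EuclideanSpace ℝ (Fin n)) 1, G (‖gradient u y‖ / max 1 I))
      ≤ ∫ y in ball (0:EuclideanSpace ℝ (Fin n)) 1, (max 1 I)⁻¹ * G (‖gradient u y‖ / 1) := by
    refine setIntegral_mono_on (grad_integrable hG hu hl0)
      ((grad_integrable hG hu one_pos).const_mul _) measurableSet_ball ?_
    intro x _
    rw [div_one, div_eq_inv_mul]
    exact hG.scale_le (norm_nonneg _) (inv_nonneg.2 hl0.le) (inv_le_one_of_one_le₀ hl)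
  rw [integral_const_mul, ← hI] at hle
  refine hle.trans ?_
  rw [inv_mul_le_iff₀ hl0, mul_one]
  exact le_max_right _ _

/-- The radial derivative. -/
noncomputable def radDeriv (u : EuclideanSpace ℝ (Fin n) → ℝ) (e : EuclideanSpace ℝ (Fin n))
    (s : ℝ) : ℝ := fderivWithin ℝ u (closedBall (0:EuclideanSpace ℝ (Fin n)) 1) (s • e) e

lemma radDeriv_cont (hu : ContDiffOn ℝ 1 u (closedBall (0:EuclideanSpace ℝ (Fin n)) 1)) {e : EuclideanSpace ℝ (Fin n)} (he : ‖e‖ = 1) :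
    ContinuousOn (radDeriv u e) (Set.Icc 0 1) := by
  have h1 : ContinuousOn (fun s : ℝ => fderivWithin ℝ u (closedBall (0:EuclideanSpace ℝ (Fin n)) 1) (s • e)) (Set.Icc 0 1) := by
    refine (hu.continuousOn_fderivWithin udiff_cB le_rfl).comp
      (by fun_prop : Continuous fun s : ℝ => s • e).continuousOn ?_
    intro s hs
    simpa [norm_smul, he, abs_of_nonneg hs.1] using hs.2
  exact h1.clm_apply continuousOn_const

lemma radDeriv_hasDerivAt (hu : ContDiffOn ℝ 1 u (closedBall (0:EuclideanSpace ℝ (Fin n)) 1)) {e : EuclideanSpace ℝ (Fin n)}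
    (he : ‖e‖ = 1) {s : ℝ} (hs : s ∈ Set.Ioo (0:ℝ) 1) :
    HasDerivAt (fun s : ℝ => u (s • e)) (radDeriv u e s) s := by
  have hns : ‖s • e‖ < 1 := by
    simpa [norm_smul, he, abs_of_pos hs.1] using hs.2
  have h1 : HasFDerivAt u (fderivWithin ℝ u (closedBall (0:EuclideanSpace ℝ (Fin n)) 1) (s • e)) (s • e) :=
    (hu.differentiableOn one_ne_zero _ (by simpa using hns.le)).hasFDerivWithinAt.hasFDerivAt
      (cB_nhds hns)
  have h2 : HasDerivAt (fun s : ℝ => s • e) e s := by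
    simpa using (hasDerivAt_id s).smul_const e
  exact h1.comp_hasDerivAt s h2

lemma radDeriv_le (hu : ContDiffOn ℝ 1 u (closedBall (0:EuclideanSpace ℝ (Fin n)) 1))
    (hrad : ∀ x ∈ (closedBall (0:EuclideanSpace ℝ (Fin n)) 1), ∀ y ∈ (closedBall (0:EuclideanSpace ℝ (Fin n)) 1), ‖x‖ = ‖y‖ → u x = u y) {e : EuclideanSpace ℝ (Fin n)}
    (he : ‖e‖ = 1) {x : EuclideanSpace ℝ (Fin n)} (hx : ‖x‖ < 1) (hx0 : x ≠ 0) :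
    |radDeriv u e ‖x‖| ≤ ‖gradient u x‖ := by
  have hxp : 0 < ‖x‖ := norm_pos_iff.2 hx0
  set e' := ‖x‖⁻¹ • x with he'
  have hn' : ‖e'‖ = 1 := by
    rw [he', norm_smul, norm_inv, norm_norm, inv_mul_cancel₀ hxp.ne']
  have hs : ‖x‖ ∈ Set.Ioo (0:ℝ) 1 := ⟨hxp, hx⟩
  have h1 := radDeriv_hasDerivAt hu he hs
  have h2 := radDeriv_hasDerivAt hu hn' hs
  have h3 : (fun s : ℝ => u (s • e)) =ᶠ[nhds ‖x‖] fun s : ℝ => u (s • e') := by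
    filter_upwards [isOpen_Ioo.mem_nhds hs] with s hs
    apply hrad
    · simpa [norm_smul, he, abs_of_pos hs.1] using hs.2.le
    · simpa [norm_smul, hn', abs_of_pos hs.1] using hs.2.le
    · simp [norm_smul, he, hn']
  have h4 : radDeriv u e ‖x‖ = radDeriv u e' ‖x‖ := (h1.congr_of_eventuallyEq h3.symm).unique h2
  have h5 : ‖x‖ • e' = x := by rw [he', smul_inv_smul₀ hxp.ne']
  rw [h4, norm_grad_eq hx, radDeriv, h5]
  have := (fderivWithin ℝ u (closedBall (0:EuclideanSpace ℝ (Fin n)) 1) x).le_opNorm e'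
  rwa [hn', mul_one, Real.norm_eq_abs] at this

lemma radial_int_le {G g : ℝ → ℝ} (hn : 2 ≤ n) (hG : IsNFunction G g) (hu : ContDiffOn ℝ 1 u (closedBall (0:EuclideanSpace ℝ (Fin n)) 1))
    (hrad : ∀ x ∈ (closedBall (0:EuclideanSpace ℝ (Fin n)) 1), ∀ y ∈ (closedBall (0:EuclideanSpace ℝ (Fin n)) 1), ‖x‖ = ‖y‖ → u x = u y) {e : EuclideanSpace ℝ (Fin n)}
    (he : ‖e‖ = 1) {m : ℝ} (hm : 0 < m)
    (hm1 : (∫ y in ball (0:EuclideanSpace ℝ (Fin n)) 1, G (‖gradient u y‖ / m)) ≤ 1) :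
    (n * (volume : Measure (EuclideanSpace ℝ (Fin n))).real (ball 0 1)) *
        ∫ r in (0:ℝ)..1, r ^ (n - 1) * G (|radDeriv u e r| / m) ≤ 1 := by
  have : Nonempty (Fin n) := ⟨⟨0, by omega⟩⟩
  rw [← polar_ball n hn (fun r => G (|radDeriv u e r| / m))]
  refine le_trans ?_ hm1
  refine integral_mono_of_nonneg ?_ (grad_integrable hG hu hm) ?_
  · exact Filter.Eventually.of_forall fun x => hG.nonneg' (by positivity)
  · have h0 : ∀ᵐ x : EuclideanSpace ℝ (Fin n), x ≠ 0 := by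
      simp [ae_iff]
    filter_upwards [ae_restrict_mem measurableSet_ball, ae_restrict_of_ae h0] with x hx hx0
    refine hG.mono' (by positivity) ?_
    gcongr
    exact radDeriv_le hu hrad he (by simpa using hx) hx0

lemma radial_pointwise {G g : ℝ → ℝ} (hn : 2 ≤ n) (hG : IsNFunction G g)
    (hu : ContDiffOn ℝ 1 u (closedBall (0:EuclideanSpace ℝ (Fin n)) 1))
    (hrad : ∀ x ∈ (closedBall (0:EuclideanSpace ℝ (Fin n)) 1), ∀ y ∈ (closedBall (0:EuclideanSpace ℝ (Fin n)) 1), ‖x‖ = ‖y‖ → u x = u y)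
    (hbd : ∀ x : EuclideanSpace ℝ (Fin n), ‖x‖ = 1 → u x = 0)
    {e : EuclideanSpace ℝ (Fin n)}
    (he : ‖e‖ = 1) {m l r : ℝ} (hr0 : 0 < r) (hr1 : r ≤ 1) (hm : 0 < m) (hl : 0 < l)
    (hm1 : (∫ y in ball (0:EuclideanSpace ℝ (Fin n)) 1, G (‖gradient u y‖ / m)) ≤ 1)
    (hl1 : (∫ s in r..1, complementaryFn G (s ^ ((1:ℝ) - n) / l) * s ^ ((n:ℝ) - 1)) ≤ 1) :
    |u (r • e)| ≤
      (1 + (n * (volume : Measure (EuclideanSpace ℝ (Fin n))).real (ball 0 1))⁻¹) * m * l := by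
  set ω := n * (volume : Measure (EuclideanSpace ℝ (Fin n))).real (ball 0 1) with hω
  have hωp : 0 < ω := by
    have : 0 < (volume : Measure (EuclideanSpace ℝ (Fin n))).real (ball 0 1) :=
      ENNReal.toReal_pos (measure_ball_pos _ _ one_pos).ne' measure_ball_lt_top.ne
    have : (0:ℝ) < n := by exact_mod_cast (by omega : 0 < n)
    positivity
  have hφ := radDeriv_cont hu he
  have hsub : Set.Icc r 1 ⊆ Set.Icc 0 1 := Set.Icc_subset_Icc_left hr0.le
  have hGc : ContinuousOn (fun s : ℝ => s ^ (n - 1) * G (|radDeriv u e s| / m)) (Set.Icc 0 1) := by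
    refine (continuous_pow _).continuousOn.mul (hG.continuousOn'.comp (hφ.abs.div_const m) ?_)
    intro s _
    exact Set.mem_Ici.2 (by positivity)
  have hf : ContinuousOn (fun s : ℝ => u (s • e)) (Set.Icc r 1) := by
    refine hu.continuousOn.comp (by fun_prop : Continuous fun s : ℝ => s • e).continuousOn ?_
    intro s hs
    simpa [norm_smul, he, abs_of_pos (hr0.trans_le hs.1)] using hs.2
  have hftc : ∫ s in r..1, radDeriv u e s = u ((1:ℝ) • e) - u (r • e) :=
    intervalIntegral.integral_eq_sub_of_hasDerivAt_of_le hr1 hf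
      (fun s hs => radDeriv_hasDerivAt hu he ⟨hr0.trans hs.1, hs.2⟩)
      ((hφ.mono hsub).intervalIntegrable_of_Icc hr1)
  have hu1 : u ((1:ℝ) • e) = 0 := hbd _ (by simpa using he)
  have h1 : |u (r • e)| ≤ ∫ s in r..1, |radDeriv u e s| := by
    have := intervalIntegral.abs_integral_le_integral_abs (f := radDeriv u e) (μ := volume) hr1
    rwa [hftc, hu1, zero_sub, abs_neg] at this
  have i1 : IntervalIntegrable (fun s : ℝ => s ^ (n - 1) * G (|radDeriv u e s| / m)) volume r 1 :=
    (hGc.mono hsub).intervalIntegrable_of_Icc hr1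
  have i2 := (tail_contOn n hG hr0 l).intervalIntegrable_of_Icc (μ := volume) hr1
  have h2 : ∫ s in r..1, |radDeriv u e s| ≤ ∫ s in r..1,
      (m * l) * (s ^ (n - 1) * G (|radDeriv u e s| / m) +
        complementaryFn G (s ^ ((1:ℝ) - n) / l) * s ^ ((n:ℝ) - 1)) := by
    refine intervalIntegral.integral_mono_on hr1
      ((hφ.mono hsub).abs.intervalIntegrable_of_Icc hr1) ((i1.add i2).const_mul _) ?_
    intro s hs
    have hs0 : 0 < s := hr0.trans_le hs.1
    have hy := hG.young (t := s ^ ((1:ℝ) - n) / l) (w := |radDeriv u e s| / m)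
      (by positivity) (by positivity)
    have e1 : s ^ (n - 1) = s ^ ((n:ℝ) - 1) := by
      rw [← Real.rpow_natCast, Nat.cast_sub (by omega), Nat.cast_one]
    have e2 : s ^ ((1:ℝ) - n) * s ^ ((n:ℝ) - 1) = 1 := by
      rw [← Real.rpow_add hs0]; simp
    have hp : 0 < s ^ ((n:ℝ) - 1) := Real.rpow_pos_of_pos hs0 _
    rw [e1]
    calc |radDeriv u e s|
        = (m * l) * ((|radDeriv u e s| / m * (s ^ ((1:ℝ) - n) / l)) * s ^ ((n:ℝ) - 1)) := by
          have : (m * l) * ((|radDeriv u e s| / m * (s ^ ((1:ℝ) - n) / l)) * s ^ ((n:ℝ) - 1))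
            = |radDeriv u e s| * (s ^ ((1:ℝ) - n) * s ^ ((n:ℝ) - 1)) := by field_simp
          rw [this, e2, mul_one]
      _ ≤ (m * l) * ((G (|radDeriv u e s| / m) + complementaryFn G (s ^ ((1:ℝ) - n) / l)) *
            s ^ ((n:ℝ) - 1)) := by gcongr
      _ = _ := by ring
  rw [intervalIntegral.integral_const_mul, intervalIntegral.integral_add i1 i2] at h2
  have h3 : ∫ s in r..1, s ^ (n - 1) * G (|radDeriv u e s| / m) ≤ ω⁻¹ := by
    have h4 : ∫ s in r..1, s ^ (n - 1) * G (|radDeriv u e s| / m) ≤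
        ∫ s in (0:ℝ)..1, s ^ (n - 1) * G (|radDeriv u e s| / m) := by
      refine intervalIntegral.integral_mono_interval hr0.le hr1 le_rfl ?_
        (hGc.intervalIntegrable_of_Icc zero_le_one)
      filter_upwards [ae_restrict_mem measurableSet_Ioc] with s hs
      exact mul_nonneg (pow_nonneg hs.1.le _) (hG.nonneg' (by positivity))
    have h5 := radial_int_le hn hG hu hrad he hm hm1
    refine h4.trans ?_
    rwa [← hω, ← le_inv_mul_iff₀ hωp, mul_one] at h5
  calc _ ≤ _ := h1.trans h2
    _ ≤ m * l * (ω⁻¹ + 1) := by gcongr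
    _ = _ := by ring

lemma radial_pointwise' {G g : ℝ → ℝ} (hn : 2 ≤ n) (hG : IsNFunction G g)
    (hu : ContDiffOn ℝ 1 u (closedBall (0:EuclideanSpace ℝ (Fin n)) 1))
    (hrad : ∀ x ∈ (closedBall (0:EuclideanSpace ℝ (Fin n)) 1), ∀ y ∈ (closedBall (0:EuclideanSpace ℝ (Fin n)) 1), ‖x‖ = ‖y‖ → u x = u y)
    (hbd : ∀ x : EuclideanSpace ℝ (Fin n), ‖x‖ = 1 → u x = 0)
    {e : EuclideanSpace ℝ (Fin n)}
    (he : ‖e‖ = 1) {r : ℝ} (hr0 : 0 < r) (hr1 : r ≤ 1) :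
    |u (r • e)| ≤
      (1 + (n * (volume : Measure (EuclideanSpace ℝ (Fin n))).real (ball 0 1))⁻¹) *
        gradLuxemburgNorm n G u * weightedTailNorm n G r := by
  set c := 1 + (n * (volume : Measure (EuclideanSpace ℝ (Fin n))).real (ball 0 1))⁻¹
  have hc : 0 ≤ c := by positivity
  have key : ∀ m ∈ {l : ℝ | 0 < l ∧
      (∫ y in ball (0:EuclideanSpace ℝ (Fin n)) 1, G (‖gradient u y‖ / l)) ≤ 1},
      |u (r • e)| ≤ c * m * weightedTailNorm n G r := by
    rintro m ⟨hm, hm1⟩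
    have hmem := closure_mono (s := {l : ℝ | 0 < l ∧
      (∫ s in r..1, complementaryFn G (s ^ ((1:ℝ) - n) / l) * s ^ ((n:ℝ) - 1)) ≤ 1})
      (t := {l | |u (r • e)| ≤ c * m * l})
      (fun l hl => radial_pointwise hn hG hu hrad hbd he hr0 hr1 hm hl.1 hm1 hl.2)
      (csInf_mem_closure (tail_nonempty n hG hr0 hr1) ⟨0, fun l hl => hl.1.le⟩)
    rwa [IsClosed.closure_eq (isClosed_le continuous_const (by fun_prop))] at hmem
  have hmem := closure_mono (t := {m | |u (r • e)| ≤ c * m * weightedTailNorm n G r}) key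
      (csInf_mem_closure (grad_nonempty hG hu) ⟨0, fun l hl => hl.1.le⟩)
  rwa [IsClosed.closure_eq (isClosed_le continuous_const (by fun_prop))] at hmem

end radial

/-- Weighted Orlicz estimate for radial functions: there is `C = C(n, q⁻, q⁺) > 0` such
that for all N-functions `G`, `H` with `q⁻ H(t) ≤ t H'(t) ≤ q⁺ H(t)`, every `α > 0`
satisfying the integrability condition
`K = ∫_0^1 r^{α+n-1} H(‖s^{1-n}‖_{L^{G̃}((r,1),s^{n-1}ds)}) dr < ∞`, and every radial
`u ∈ C¹(B̄)` vanishing on `∂B`: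
`∫_B |x|^α H(|u|) dx ≤ C max(‖∇u‖_{L^G(B)}^{q⁻}, ‖∇u‖_{L^G(B)}^{q⁺}) K < ∞`. -/
theorem weighted_orlicz_estimate_radial (n : ℕ) (hn : 2 ≤ n)
    (qm qp : ℝ) (hqm : 1 < qm) (hq : qm ≤ qp) :
    ∃ C > (0:ℝ), ∀ (G g H h : ℝ → ℝ) (α : ℝ), 0 < α →
      IsNFunction G g → IsNFunction H h →
      (∀ t > (0:ℝ), qm * H t ≤ t * h t ∧ t * h t ≤ qp * H t) →
      IntervalIntegrable (fun r => r ^ (α + n - 1) * H (weightedTailNorm n G r))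
        volume 0 1 →
      ∀ u : EuclideanSpace ℝ (Fin n) → ℝ,
        ContDiffOn ℝ 1 u (closedBall 0 1) →
        (∀ x ∈ closedBall (0:EuclideanSpace ℝ (Fin n)) 1,
          ∀ y ∈ closedBall (0:EuclideanSpace ℝ (Fin n)) 1, ‖x‖ = ‖y‖ → u x = u y) →
        (∀ x : EuclideanSpace ℝ (Fin n), ‖x‖ = 1 → u x = 0) →
        IntegrableOn (fun x => ‖x‖ ^ α * H |u x|)
          (ball (0:EuclideanSpace ℝ (Fin n)) 1) ∧
        (∫ x in ball (0:EuclideanSpace ℝ (Fin n)) 1, ‖x‖ ^ α * H |u x|) ≤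
          C * max (gradLuxemburgNorm n G u ^ qm) (gradLuxemburgNorm n G u ^ qp) *
            (∫ r in (0:ℝ)..1, r ^ (α + n - 1) * H (weightedTailNorm n G r)) := by
  have : Nonempty (Fin n) := ⟨⟨0, by omega⟩⟩
  set ω := n * (volume : Measure (EuclideanSpace ℝ (Fin n))).real (ball 0 1) with hω
  have hωp : 0 < ω := by
    have : 0 < (volume : Measure (EuclideanSpace ℝ (Fin n))).real (ball 0 1) :=
      ENNReal.toReal_pos (measure_ball_pos _ _ one_pos).ne' measure_ball_lt_top.ne
    have : (0:ℝ) < n := by exact_mod_cast (by omega : 0 < n)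
    positivity
  set c := 1 + ω⁻¹ with hcdef
  have hc1 : 1 ≤ c := by
    have := inv_pos.2 hωp
    linarith
  have hc0 : 0 < c := zero_lt_one.trans_le hc1
  refine ⟨ω * c ^ qp, by positivity, ?_⟩
  intro G g H h α hα hG hH hHq hK u hu hrad hbd
  obtain ⟨e, he⟩ : ∃ e : EuclideanSpace ℝ (Fin n), ‖e‖ = 1 := exists_norm_eq _ zero_le_one
  have hcont : ContinuousOn (fun x : EuclideanSpace ℝ (Fin n) => ‖x‖ ^ α * H |u x|)
      (closedBall 0 1) := by
    refine (continuous_norm.rpow_const (fun _ => Or.inr hα.le)).continuousOn.mul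
      (hH.continuousOn'.comp hu.continuousOn.abs ?_)
    intro x _
    exact Set.mem_Ici.2 (abs_nonneg _)
  refine ⟨(hcont.integrableOn_compact (isCompact_closedBall _ _)).mono_set
    ball_subset_closedBall, ?_⟩
  have h1 : (∫ x in ball (0:EuclideanSpace ℝ (Fin n)) 1, ‖x‖ ^ α * H |u x|) =
      ∫ x in ball (0:EuclideanSpace ℝ (Fin n)) 1,
        (fun r : ℝ => r ^ α * H |u (r • e)|) ‖x‖ := by
    refine setIntegral_congr_fun measurableSet_ball ?_
    intro x hx
    have hx' : ‖x‖ < 1 := by simpa using hx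
    simp only
    rw [hrad x (by simpa using hx'.le) (‖x‖ • e) (by simpa [norm_smul, he] using hx'.le)
      (by simp [norm_smul, he])]
  rw [h1, polar_ball n hn (fun r : ℝ => r ^ α * H |u (r • e)|), ← hω]
  set N := gradLuxemburgNorm n G u with hN
  have hN0 : 0 ≤ N := gradNorm_nonneg n G u
  have hmax : max ((c * N) ^ qm) ((c * N) ^ qp) ≤ c ^ qp * max (N ^ qm) (N ^ qp) := by
    rw [Real.mul_rpow hc0.le hN0, Real.mul_rpow hc0.le hN0]
    have := Real.rpow_le_rpow_of_exponent_le hc1 hq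
    have hNm := Real.rpow_nonneg hN0 qm
    have hcp := Real.rpow_nonneg hc0.le qp
    refine max_le ?_ ?_
    · exact (mul_le_mul_of_nonneg_right this hNm).trans
        (mul_le_mul_of_nonneg_left (le_max_left _ _) hcp)
    · exact mul_le_mul_of_nonneg_left (le_max_right _ _) hcp
  have h2 : (∫ r in (0:ℝ)..1, r ^ (n - 1) * (r ^ α * H |u (r • e)|)) ≤
      ∫ r in (0:ℝ)..1, (c ^ qp * max (N ^ qm) (N ^ qp)) *
        (r ^ (α + n - 1) * H (weightedTailNorm n G r)) := by
    rw [intervalIntegral.integral_of_le zero_le_one, intervalIntegral.integral_of_le zero_le_one]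
    refine integral_mono_of_nonneg ?_
      ((intervalIntegrable_iff_integrableOn_Ioc_of_le zero_le_one).1 (hK.const_mul _)) ?_
    · filter_upwards [ae_restrict_mem measurableSet_Ioc] with r hr
      have := hH.nonneg' (abs_nonneg (u (r • e)))
      have := hr.1
      simp only [Pi.zero_apply]
      positivity
    · filter_upwards [ae_restrict_mem measurableSet_Ioc] with r hr
      have hr0 : 0 < r := hr.1
      have hp := radial_pointwise' hn hG hu hrad hbd he hr.1 hr.2
      have hT := tailNorm_nonneg n G r
      have h3 : H |u (r • e)| ≤ c ^ qp * max (N ^ qm) (N ^ qp) * H (weightedTailNorm n G r) :=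
        ((hH.mono' (abs_nonneg _) hp).trans
          (hH.growth hHq (mul_nonneg hc0.le hN0) hT)).trans
          (mul_le_mul_of_nonneg_right hmax (hH.nonneg' hT))
      have e1 : r ^ (α + n - 1) = r ^ (n - 1) * r ^ α := by
        rw [← Real.rpow_natCast, ← Real.rpow_add hr0, Nat.cast_sub (by omega), Nat.cast_one]
        congr 1; ring
      rw [e1, ← mul_assoc]
      calc _ ≤ r ^ (n - 1) * r ^ α *
            (c ^ qp * max (N ^ qm) (N ^ qp) * H (weightedTailNorm n G r)) := by gcongr
        _ = _ := by ring
  rw [intervalIntegral.integral_const_mul] at h2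
  calc _ ≤ _ := mul_le_mul_of_nonneg_left h2 hωp.le
    _ = _ := by ring
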